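/- arXiv:2108.08746 — 3 statements merged into one kernel-verified Lean document; each statement's English description precedes it below -/
import Mathlib

section
/- For every fixed R > 0, one has lim_{γ → 1⁻} I_{0,γ}(R) = 6 and lim_{γ → 1⁻} I_{∞,γ}(R) = 0. -/
open MeasureTheory

/-- Modified Bessel function of the second kind:
`K_ν(x) = ∫₀^∞ exp(−x cosh s) cosh(ν s) ds` (so `K_{−ν} = K_ν`). -/
noncomputable def besselK (ν x : ℝ) : ℝ :=
  ∫ s in Set.Ioi (0 : ℝ), Real.exp (-x * Real.cosh s) * Real.cosh (ν * s)

/-- Modified Bessel function of the first kind: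
`I_ν(x) = Σ_{j≥0} (x/2)^{2j+ν}/(j! Γ(ν+j+1))`. -/
noncomputable def besselI (ν x : ℝ) : ℝ :=
  ∑' j : ℕ, (x / 2) ^ (2 * (j : ℝ) + ν) / ((j.factorial : ℝ) * Real.Gamma (ν + j + 1))

/-- Normalizing constant `C(3,γ) = 2^{2γ} Γ(3/2+γ)/(π^{3/2} |Γ(−γ)|)`. -/
noncomputable def C3 (γ : ℝ) : ℝ :=
  2 ^ (2 * γ) * Real.Gamma (3 / 2 + γ) / (Real.pi ^ ((3 : ℝ) / 2) * |Real.Gamma (-γ)|)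

/-- The kernel
`K_γ(ρ) = C(3,γ) (sinh ρ)⁻¹ ρ^{−1/2−γ} · 2 K_{3/2+γ}(ρ) / (Γ(3/2+γ) 2^{3/2+γ})`. -/
noncomputable def Kker (γ ρ : ℝ) : ℝ :=
  C3 γ * (Real.sinh ρ)⁻¹ * ρ ^ (-(1 / 2 : ℝ) - γ) * (2 * besselK (3 / 2 + γ) ρ) /
    (Real.Gamma (3 / 2 + γ) * 2 ^ ((3 : ℝ) / 2 + γ))

/-- Scale function `I_{0,γ}(R) = 4π ∫₀^R ρ² K_γ(ρ) sinh²ρ dρ`. -/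
noncomputable def scaleI0 (γ R : ℝ) : ℝ :=
  4 * Real.pi * ∫ ρ in (0 : ℝ)..R, ρ ^ 2 * Kker γ ρ * (Real.sinh ρ) ^ 2

/-- Scale function `I_{∞,γ}(R) = 4π R² ∫_R^∞ K_γ(ρ) sinh²ρ dρ`. -/
noncomputable def scaleIinf (γ R : ℝ) : ℝ :=
  4 * Real.pi * R ^ 2 * ∫ ρ in Set.Ioi R, Kker γ ρ * (Real.sinh ρ) ^ 2

open Filter Topology

noncomputable def auxJ (ν ρ : ℝ) : ℝ :=
  ∫ t in Set.Ioi (0 : ℝ), t ^ (ν - 1) * Real.exp (-t - ρ ^ 2 / (4 * t))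

lemma aux_gamma_int {ν : ℝ} (hν : 0 < ν) :
    IntegrableOn (fun t : ℝ => t ^ (ν - 1) * Real.exp (-t)) (Set.Ioi 0) := by
  have h := Real.GammaIntegral_convergent hν
  refine h.congr_fun (fun t _ => ?_) measurableSet_Ioi
  exact mul_comm _ _

lemma aux_J_int {ν : ℝ} (hν : 0 < ν) (ρ : ℝ) :
    IntegrableOn (fun t : ℝ => t ^ (ν - 1) * Real.exp (-t - ρ ^ 2 / (4 * t))) (Set.Ioi 0) := by
  refine Integrable.mono' (aux_gamma_int hν) ?_ ?_
  · apply Measurable.aestronglyMeasurable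
    fun_prop
  · filter_upwards [ae_restrict_mem measurableSet_Ioi] with t ht
    have ht : 0 < t := ht
    rw [Real.norm_of_nonneg (by positivity)]
    gcongr
    have : 0 ≤ ρ ^ 2 / (4 * t) := by positivity
    linarith

lemma aux_J_nonneg (ν ρ : ℝ) : 0 ≤ auxJ ν ρ := by
  refine setIntegral_nonneg measurableSet_Ioi (fun t ht => ?_)
  have ht : 0 < t := ht
  positivity

lemma aux_Gamma_eq {ν : ℝ} (hν : 0 < ν) :
    Real.Gamma ν = ∫ t in Set.Ioi (0 : ℝ), t ^ (ν - 1) * Real.exp (-t) := by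
  rw [Real.Gamma_eq_integral hν]
  simp only [mul_comm]

lemma aux_J_le {ν : ℝ} (hν : 0 < ν) (ρ : ℝ) : auxJ ν ρ ≤ Real.Gamma ν := by
  rw [aux_Gamma_eq hν]
  refine setIntegral_mono_on (aux_J_int hν ρ) (aux_gamma_int hν) measurableSet_Ioi (fun t ht => ?_)
  have ht : 0 < t := ht
  gcongr
  have : 0 ≤ ρ ^ 2 / (4 * t) := by positivity
  linarith

lemma aux_J_ge {ν : ℝ} (hν : 1 < ν) (ρ : ℝ) :
    Real.Gamma ν - ρ ^ 2 / 4 * Real.Gamma (ν - 1) ≤ auxJ ν ρ := by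
  have h0 : 0 < ν := by linarith
  rw [aux_Gamma_eq h0, aux_Gamma_eq (by linarith : 0 < ν - 1), ← integral_const_mul,
    ← integral_sub (aux_gamma_int h0) ((aux_gamma_int (by linarith : 0 < ν - 1)).const_mul _)]
  refine setIntegral_mono_on ((aux_gamma_int h0).sub
    ((aux_gamma_int (by linarith : 0 < ν - 1)).const_mul _)) (aux_J_int h0 ρ) measurableSet_Ioi
    (fun t ht => ?_)
  have ht : 0 < t := ht
  have e1 : t ^ (ν - 1) = t ^ (ν - 1 - 1) * t := by
    rw [← Real.rpow_add_one ht.ne']; congr 1; ring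
  have e2 : Real.exp (-t - ρ ^ 2 / (4 * t)) = Real.exp (-t) * Real.exp (-(ρ ^ 2 / (4 * t))) := by
    rw [← Real.exp_add]; congr 1
  have e3 : 1 - ρ ^ 2 / (4 * t) ≤ Real.exp (-(ρ ^ 2 / (4 * t))) := by
    have := Real.add_one_le_exp (-(ρ ^ 2 / (4 * t))); linarith
  rw [e2, e1]
  have e4 := mul_le_mul_of_nonneg_left e3
    (by positivity : 0 ≤ t ^ (ν - 1 - 1) * t * Real.exp (-t))
  have e5 : t ^ (ν - 1 - 1) * t * Real.exp (-t) * (1 - ρ ^ 2 / (4 * t)) =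
    t ^ (ν - 1 - 1) * t * Real.exp (-t) - ρ ^ 2 / 4 * (t ^ (ν - 1 - 1) * Real.exp (-t)) := by
    field_simp
  linarith

lemma aux_image {ρ : ℝ} (hρ : 0 < ρ) :
    (fun s : ℝ => ρ / 2 * Real.exp s) '' Set.univ = Set.Ioi 0 := by
  ext t
  simp only [Set.image_univ, Set.mem_range, Set.mem_Ioi]
  constructor
  · rintro ⟨s, rfl⟩; positivity
  · intro ht
    refine ⟨Real.log (2 * t / ρ), ?_⟩
    rw [Real.exp_log (by positivity)]
    field_simp

lemma aux_sub {ν ρ : ℝ} (hρ : 0 < ρ) (s : ℝ) :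
    |ρ / 2 * Real.exp s| • ((ρ / 2 * Real.exp s) ^ (ν - 1) *
      Real.exp (-(ρ / 2 * Real.exp s) - ρ ^ 2 / (4 * (ρ / 2 * Real.exp s)))) =
    (ρ / 2) ^ ν * (Real.exp (-ρ * Real.cosh s) * Real.exp (ν * s)) := by
  have hp : 0 < ρ / 2 * Real.exp s := by positivity
  rw [abs_of_pos hp, smul_eq_mul, ← mul_assoc, mul_comm (ρ / 2 * Real.exp s),
    ← Real.rpow_add_one hp.ne', sub_add_cancel, Real.mul_rpow (by positivity) (by positivity),
    ← Real.exp_mul, mul_comm s ν]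
  have : -(ρ / 2 * Real.exp s) - ρ ^ 2 / (4 * (ρ / 2 * Real.exp s)) = -ρ * Real.cosh s := by
    rw [Real.cosh_eq, Real.exp_neg]
    have := Real.exp_pos s
    field_simp
    ring
  rw [this]; ring

lemma aux_exp_int {ν ρ : ℝ} (hν : 0 < ν) (hρ : 0 < ρ) :
    Integrable (fun s : ℝ => Real.exp (-ρ * Real.cosh s) * Real.exp (ν * s)) := by
  have hd : ∀ x ∈ (Set.univ : Set ℝ), HasDerivWithinAt (fun s : ℝ => ρ / 2 * Real.exp s)
      (ρ / 2 * Real.exp x) Set.univ x := fun x _ =>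
    ((Real.hasDerivAt_exp x).const_mul _).hasDerivWithinAt
  have hinj : Set.InjOn (fun s : ℝ => ρ / 2 * Real.exp s) Set.univ := by
    intro a _ b _ h
    have : (ρ / 2) ≠ 0 := by positivity
    exact Real.exp_injective (mul_left_cancel₀ this h)
  have h := (integrableOn_image_iff_integrableOn_abs_deriv_smul MeasurableSet.univ hd hinj
    (fun t : ℝ => t ^ (ν - 1) * Real.exp (-t - ρ ^ 2 / (4 * t)))).1
  rw [aux_image hρ] at h
  have h2 := h (aux_J_int hν ρ)
  simp only [aux_sub hρ, integrableOn_univ] at h2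
  have h3 := h2.const_mul (((ρ / 2) ^ ν)⁻¹)
  have : (ρ / 2) ^ ν ≠ 0 := by positivity
  simpa only [inv_mul_cancel_left₀ this] using h3

lemma aux_exp_eq {ν ρ : ℝ} (hρ : 0 < ρ) :
    auxJ ν ρ = (ρ / 2) ^ ν * ∫ s : ℝ, Real.exp (-ρ * Real.cosh s) * Real.exp (ν * s) := by
  have hd : ∀ x ∈ (Set.univ : Set ℝ), HasDerivWithinAt (fun s : ℝ => ρ / 2 * Real.exp s)
      (ρ / 2 * Real.exp x) Set.univ x := fun x _ =>
    ((Real.hasDerivAt_exp x).const_mul _).hasDerivWithinAt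
  have hinj : Set.InjOn (fun s : ℝ => ρ / 2 * Real.exp s) Set.univ := by
    intro a _ b _ h
    have : (ρ / 2) ≠ 0 := by positivity
    exact Real.exp_injective (mul_left_cancel₀ this h)
  have h := (integral_image_eq_integral_abs_deriv_smul MeasurableSet.univ hd hinj
    (fun t : ℝ => t ^ (ν - 1) * Real.exp (-t - ρ ^ 2 / (4 * t))))
  rw [aux_image hρ] at h
  simp only [aux_sub hρ, Measure.restrict_univ] at h
  rw [auxJ, h, integral_const_mul]

lemma aux_cosh_fun (ν ρ : ℝ) :
    (fun s : ℝ => Real.exp (-ρ * Real.cosh s) * Real.cosh (ν * s)) = fun s : ℝ =>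
    (1 / 2) * (Real.exp (-ρ * Real.cosh s) * Real.exp (ν * s)) +
    (1 / 2) * (Real.exp (-ρ * Real.cosh (-s)) * Real.exp (ν * (-s))) := by
  funext s
  rw [Real.cosh_neg, Real.cosh_eq (ν * s), mul_neg]
  ring

lemma aux_cosh_int {ν ρ : ℝ} (hν : 0 < ν) (hρ : 0 < ρ) :
    Integrable (fun s : ℝ => Real.exp (-ρ * Real.cosh s) * Real.cosh (ν * s)) := by
  rw [aux_cosh_fun]
  exact ((aux_exp_int hν hρ).const_mul _).add ((aux_exp_int hν hρ).comp_neg.const_mul _)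

lemma aux_bessel {ν ρ : ℝ} (hν : 0 < ν) (hρ : 0 < ρ) :
    auxJ ν ρ = (ρ / 2) ^ ν * (2 * besselK ν ρ) := by
  rw [aux_exp_eq hρ]
  congr 1
  have h1 := integral_comp_abs (f := fun s : ℝ => Real.exp (-ρ * Real.cosh s) * Real.cosh (ν * s))
  have h2 : ∀ s : ℝ, Real.cosh (ν * |s|) = Real.cosh (ν * s) := by
    intro s
    rcases abs_choice s with h | h <;> rw [h]
    rw [mul_neg, Real.cosh_neg]
  simp only [Real.cosh_abs, h2] at h1
  rw [besselK, ← h1, aux_cosh_fun, integral_add ((aux_exp_int hν hρ).const_mul _)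
    ((aux_exp_int hν hρ).comp_neg.const_mul _), integral_const_mul, integral_const_mul,
    integral_neg_eq_self (fun s : ℝ => Real.exp (-ρ * Real.cosh s) * Real.exp (ν * s))]
  ring

lemma aux_K_nonneg (ν ρ : ℝ) : 0 ≤ besselK ν ρ := by
  refine setIntegral_nonneg measurableSet_Ioi (fun t ht => ?_)
  have := Real.cosh_pos (ν * t)
  positivity

lemma aux_K_bound {ν R ρ : ℝ} (hν : 0 < ν) (hν' : ν ≤ 5 / 2) (hR : 0 < R) (h : R ≤ ρ) :
    Real.exp ρ * besselK ν ρ ≤ Real.exp R * besselK (5 / 2) R := by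
  unfold besselK
  rw [← integral_const_mul, ← integral_const_mul]
  refine setIntegral_mono_on ((aux_cosh_int hν (hR.trans_le h)).integrableOn.const_mul _)
    ((aux_cosh_int (by norm_num) hR).integrableOn.const_mul _) measurableSet_Ioi (fun s hs => ?_)
  have hs : 0 < s := hs
  rw [← mul_assoc, ← mul_assoc, ← Real.exp_add, ← Real.exp_add]
  have hc := Real.one_le_cosh s
  have h1 : Real.cosh (ν * s) ≤ Real.cosh (5 / 2 * s) := by
    rw [Real.cosh_le_cosh, abs_of_pos (by positivity), abs_of_pos (by positivity)]
    gcongr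
  have := Real.cosh_pos (ν * s)
  have h2 : ρ + -ρ * Real.cosh s ≤ R + -R * Real.cosh s := by nlinarith
  exact mul_le_mul (Real.exp_le_exp.2 h2) h1 this.le (Real.exp_pos _).le

lemma aux_J_meas (ν : ℝ) : Measurable (fun ρ => auxJ ν ρ) := by
  unfold auxJ
  apply StronglyMeasurable.measurable
  apply StronglyMeasurable.integral_prod_right'
    (f := fun p : ℝ × ℝ => p.2 ^ (ν - 1) * Real.exp (-p.2 - p.1 ^ 2 / (4 * p.2)))
  apply Measurable.stronglyMeasurable
  fun_prop

noncomputable def auxD (γ : ℝ) : ℝ := γ * 2 ^ (2 * γ) / (Real.pi ^ ((3 : ℝ) / 2) * Real.Gamma (2 - γ))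

lemma aux_C3 {γ : ℝ} (h0 : 0 < γ) (h1 : γ < 1) :
    C3 γ = Real.Gamma (3 / 2 + γ) * ((1 - γ) * auxD γ) := by
  have e1 : Real.Gamma (1 - γ) = -γ * Real.Gamma (-γ) := by
    rw [← Real.Gamma_add_one (by linarith)]; congr 1; ring
  have e2 : Real.Gamma (2 - γ) = (1 - γ) * Real.Gamma (1 - γ) := by
    rw [← Real.Gamma_add_one (by linarith)]; congr 1; ring
  have hp : 0 < Real.Gamma (2 - γ) := Real.Gamma_pos_of_pos (by linarith)
  have hp1 : 0 < Real.Gamma (1 - γ) := Real.Gamma_pos_of_pos (by linarith)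
  have e3 : Real.Gamma (-γ) = - (Real.Gamma (1 - γ) / γ) := by rw [e1]; field_simp
  have h1' : 0 < 1 - γ := by linarith
  rw [C3, auxD, e2, e3, abs_neg, abs_of_pos (by positivity)]
  field_simp

lemma aux_kernel {γ ρ : ℝ} (h0 : 0 < γ) (h1 : γ < 1) (hρ : 0 < ρ) :
    ρ ^ 2 * Kker γ ρ * (Real.sinh ρ) ^ 2 =
    ((1 - γ) * auxD γ) * (ρ ^ (1 - 2 * γ) * (Real.sinh ρ / ρ * auxJ (3 / 2 + γ) ρ)) := by
  have hs : 0 < Real.sinh ρ := Real.sinh_pos_iff.2 hρ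
  have hG : 0 < Real.Gamma (3 / 2 + γ) := Real.Gamma_pos_of_pos (by linarith)
  rw [Kker, aux_C3 h0 h1, aux_bessel (by linarith) hρ, Real.div_rpow hρ.le (by norm_num)]
  have e : ρ ^ (-(1 / 2 : ℝ) - γ) * ρ ^ 2 = ρ ^ (1 - 2 * γ) / ρ * ρ ^ (3 / 2 + γ) := by
    rw [← Real.rpow_natCast, ← Real.rpow_add hρ, ← Real.rpow_sub_one hρ.ne', ← Real.rpow_add hρ]
    congr 1; push_cast; ring
  have : (0:ℝ) < 2 ^ ((3 : ℝ) / 2 + γ) := by positivity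
  field_simp
  field_simp at e
  linear_combination ((1 - γ) * auxD γ * besselK ((3 + 2 * γ) / 2) ρ) * e

lemma aux_kernel2 {γ ρ : ℝ} (h0 : 0 < γ) (h1 : γ < 1) (hρ : 0 < ρ) :
    Kker γ ρ * (Real.sinh ρ) ^ 2 =
    ((1 - γ) * auxD γ * 2 / 2 ^ ((3 : ℝ) / 2 + γ)) *
      (Real.sinh ρ * ρ ^ (-(1 / 2 : ℝ) - γ) * besselK (3 / 2 + γ) ρ) := by
  have hs : 0 < Real.sinh ρ := Real.sinh_pos_iff.2 hρ
  have hG : 0 < Real.Gamma (3 / 2 + γ) := Real.Gamma_pos_of_pos (by linarith)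
  rw [Kker, aux_C3 h0 h1]
  field_simp

lemma aux_D_cont : ContinuousAt auxD 1 := by
  unfold auxD
  have hG : ContinuousAt (fun γ : ℝ => Real.Gamma (2 - γ)) 1 := by
    apply ContinuousAt.comp (g := Real.Gamma)
    · refine (Real.differentiableAt_Gamma (fun m => ?_)).continuousAt
      have : (0:ℝ) ≤ m := by positivity
      linarith
    · fun_prop
  have h2 : ContinuousAt (fun γ : ℝ => (2:ℝ) ^ (2 * γ)) 1 := by
    apply Continuous.continuousAt
    exact Continuous.rpow continuous_const (by fun_prop) (fun x => Or.inl (by norm_num))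
  refine ContinuousAt.div (continuousAt_id.mul h2) (continuousAt_const.mul hG) ?_
  have : 0 < Real.Gamma (2 - 1) := Real.Gamma_pos_of_pos (by norm_num)
  positivity

lemma aux_D_one : auxD 1 = 4 / Real.pi ^ ((3 : ℝ) / 2) := by
  unfold auxD
  norm_num [Real.Gamma_one]

lemma aux_Gamma_five : Real.Gamma (5 / 2) = 3 / 4 * Real.pi ^ ((1 : ℝ) / 2) := by
  have e : (5 / 2 : ℝ) = 1 / 2 + 1 + 1 := by norm_num
  rw [e, Real.Gamma_add_one (by norm_num), Real.Gamma_add_one (by norm_num),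
    Real.Gamma_one_half_eq, Real.sqrt_eq_rpow]
  ring

lemma aux_Gamma_cont {c : ℝ} (hc : 0 < c + 1) :
    ContinuousAt (fun γ : ℝ => Real.Gamma (c + γ)) 1 := by
  apply ContinuousAt.comp (g := Real.Gamma)
  · refine (Real.differentiableAt_Gamma (fun m => ?_)).continuousAt
    have : (0:ℝ) ≤ m := by positivity
    linarith
  · fun_prop

lemma aux_tail {R γ : ℝ} (hR : 0 < R) (h0 : 3 / 4 < γ) (h1 : γ < 1) :
    |∫ ρ in Set.Ioi R, Real.sinh ρ * ρ ^ (-(1 / 2 : ℝ) - γ) * besselK (3 / 2 + γ) ρ| ≤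
    ∫ ρ in Set.Ioi R, (Real.exp R * besselK (5 / 2) R) * (ρ ^ (-(5/4) : ℝ) + ρ ^ (-(3/2) : ℝ)) := by
  rw [← Real.norm_eq_abs]
  refine norm_integral_le_of_norm_le (Integrable.const_mul (Integrable.add
    (integrableOn_Ioi_rpow_of_lt (by norm_num) hR)
    (integrableOn_Ioi_rpow_of_lt (by norm_num) hR)) _) ?_
  filter_upwards [ae_restrict_mem measurableSet_Ioi] with ρ hρ
  have hρ : R < ρ := hρ
  have hp : 0 < ρ := hR.trans hρ
  have hs : 0 < Real.sinh ρ := Real.sinh_pos_iff.2 hp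
  have hK := aux_K_nonneg (3 / 2 + γ) ρ
  rw [Real.norm_of_nonneg (by positivity)]
  have hb := aux_K_bound (ν := 3 / 2 + γ) (by linarith) (by linarith) hR hρ.le
  have hse : Real.sinh ρ ≤ Real.exp ρ := by
    rw [Real.sinh_eq]; have := Real.exp_pos ρ; have := Real.exp_pos (-ρ); linarith
  have hr : ρ ^ (-(1 / 2 : ℝ) - γ) ≤ ρ ^ (-(5/4) : ℝ) + ρ ^ (-(3/2) : ℝ) := by
    have a1 : 0 ≤ ρ ^ (-(5/4) : ℝ) := by positivity
    have a2 : 0 ≤ ρ ^ (-(3/2) : ℝ) := by positivity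
    rcases le_total 1 ρ with h | h
    · have := Real.rpow_le_rpow_of_exponent_le h (by linarith : -(1 / 2 : ℝ) - γ ≤ -(5/4))
      linarith
    · have := Real.rpow_le_rpow_of_exponent_ge hp h (by linarith : -(3/2) ≤ -(1 / 2 : ℝ) - γ)
      linarith
  calc Real.sinh ρ * ρ ^ (-(1 / 2 : ℝ) - γ) * besselK (3 / 2 + γ) ρ
      = (Real.sinh ρ * besselK (3 / 2 + γ) ρ) * ρ ^ (-(1 / 2 : ℝ) - γ) := by ring
    _ ≤ (Real.exp ρ * besselK (3 / 2 + γ) ρ) * ρ ^ (-(1 / 2 : ℝ) - γ) := by gcongr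
    _ ≤ _ := mul_le_mul hb hr (by positivity)
        (mul_nonneg (Real.exp_pos _).le (aux_K_nonneg _ _))

lemma aux_sinh_le {x R : ℝ} (hx : x ∈ Set.Icc 0 R) : Real.sinh x ≤ x * Real.cosh R := by
  have hd : ∀ y ∈ Set.Icc 0 R, ‖deriv Real.sinh y‖ ≤ Real.cosh R := by
    intro y hy
    rw [Real.deriv_sinh, Real.norm_of_nonneg (Real.cosh_pos y).le, Real.cosh_le_cosh,
      abs_of_nonneg hy.1, abs_of_nonneg (hy.1.trans hy.2)]
    exact hy.2
  have := (convex_Icc (0:ℝ) R).norm_image_sub_le_of_norm_deriv_le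
    (fun y _ => Real.differentiable_sinh y) hd
    (Set.left_mem_Icc.2 (hx.1.trans hx.2)) hx
  simp only [Real.sinh_zero, sub_zero, Real.norm_eq_abs, abs_of_nonneg hx.1] at this
  linarith [le_abs_self (Real.sinh x)]

lemma aux_pt {R γ ρ : ℝ} (h0 : 0 < γ) (hp : 0 < ρ) (hρ : ρ ≤ R) :
    |Real.sinh ρ / ρ * auxJ (3 / 2 + γ) ρ - Real.Gamma (3 / 2 + γ)| ≤
    (Real.cosh R * Real.Gamma (3 / 2 + γ) + R / 4 * Real.Gamma (1 / 2 + γ)) * ρ := by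
  have hJ0 := aux_J_nonneg (3 / 2 + γ) ρ
  have hJ1 := aux_J_le (ν := 3 / 2 + γ) (by linarith) ρ
  have hJ2 := aux_J_ge (ν := 3 / 2 + γ) (by linarith) ρ
  rw [show 3 / 2 + γ - 1 = 1 / 2 + γ by ring] at hJ2
  have hG := Real.Gamma_pos_of_pos (by linarith : 0 < 1 / 2 + γ)
  set J := auxJ (3 / 2 + γ) ρ
  set G := Real.Gamma (3 / 2 + γ)
  set G' := Real.Gamma (1 / 2 + γ)
  have s1 : 1 ≤ Real.sinh ρ / ρ := by
    rw [le_div_iff₀ hp, one_mul]; exact Real.self_le_sinh_iff.2 hp.le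
  have s2 : Real.sinh ρ / ρ - 1 ≤ Real.cosh R * ρ := by
    have h1 : Real.sinh ρ / ρ ≤ Real.cosh ρ := by
      rw [div_le_iff₀ hp, mul_comm]
      exact aux_sinh_le ⟨hp.le, le_rfl⟩
    have h2 : Real.cosh ρ - 1 ≤ Real.sinh ρ := by
      have := Real.cosh_sub_sinh ρ
      have : Real.exp (-ρ) ≤ 1 := Real.exp_le_one_iff.2 (by linarith)
      linarith
    have := aux_sinh_le (R := R) ⟨hp.le, hρ⟩
    linarith
  set S := Real.sinh ρ / ρ
  have hc := Real.cosh_pos R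
  have k1 : (S - 1) * J ≤ Real.cosh R * ρ * G := by
    apply mul_le_mul s2 hJ1 hJ0 (by positivity)
  have k0 : 0 ≤ (S - 1) * J := mul_nonneg (by linarith) hJ0
  have k2 : ρ ^ 2 / 4 * G' ≤ R / 4 * G' * ρ := by
    have : ρ * ρ ≤ R * ρ := by gcongr
    nlinarith
  have k3 : 0 ≤ Real.cosh R * ρ * G := le_trans k0 k1
  have k4 : 0 ≤ R / 4 * G' * ρ := le_trans (by positivity) k2
  rw [abs_le]
  constructor <;> nlinarith

lemma aux_main {R γ : ℝ} (hR : 0 < R) (h0 : 0 < γ) (h1 : γ < 1) :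
    |(∫ ρ in (0 : ℝ)..R, ρ ^ (1 - 2 * γ) * (Real.sinh ρ / ρ * auxJ (3 / 2 + γ) ρ)) -
      Real.Gamma (3 / 2 + γ) * (R ^ (2 - 2 * γ) / (2 - 2 * γ))| ≤
    (Real.cosh R * Real.Gamma (3 / 2 + γ) + R / 4 * Real.Gamma (1 / 2 + γ)) *
      (R ^ (3 - 2 * γ) / (3 - 2 * γ)) := by
  set B := (Real.cosh R * Real.Gamma (3 / 2 + γ) + R / 4 * Real.Gamma (1 / 2 + γ)) with hB
  set G := Real.Gamma (3 / 2 + γ) with hG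
  have i1 : IntervalIntegrable (fun ρ : ℝ => ρ ^ (1 - 2 * γ)) volume 0 R :=
    intervalIntegral.intervalIntegrable_rpow' (by linarith)
  have i2 : IntervalIntegrable (fun ρ : ℝ => ρ ^ (2 - 2 * γ)) volume 0 R :=
    intervalIntegral.intervalIntegrable_rpow' (by linarith)
  have v1 : ∫ ρ in (0 : ℝ)..R, ρ ^ (1 - 2 * γ) = R ^ (2 - 2 * γ) / (2 - 2 * γ) := by
    rw [integral_rpow (Or.inl (by linarith)), show 1 - 2 * γ + 1 = 2 - 2 * γ by ring,
      Real.zero_rpow (by linarith), sub_zero]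
  have v2 : ∫ ρ in (0 : ℝ)..R, ρ ^ (2 - 2 * γ) = R ^ (3 - 2 * γ) / (3 - 2 * γ) := by
    rw [integral_rpow (Or.inl (by linarith)), show 2 - 2 * γ + 1 = 3 - 2 * γ by ring,
      Real.zero_rpow (by linarith), sub_zero]
  have hpt : ∀ ρ ∈ Set.Ioc 0 R, ‖ρ ^ (1 - 2 * γ) * (Real.sinh ρ / ρ * auxJ (3 / 2 + γ) ρ - G)‖ ≤
      B * ρ ^ (2 - 2 * γ) := by
    intro ρ hρ
    have hp : 0 < ρ := hρ.1
    rw [norm_mul, Real.norm_of_nonneg (by positivity), Real.norm_eq_abs]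
    have e : ρ ^ (2 - 2 * γ) = ρ ^ (1 - 2 * γ) * ρ := by
      rw [← Real.rpow_add_one hp.ne']; congr 1; ring
    rw [e]
    have := mul_le_mul_of_nonneg_left (aux_pt h0 hp hρ.2) (by positivity : 0 ≤ ρ ^ (1 - 2 * γ))
    refine this.trans (le_of_eq ?_)
    ring
  have hm : Measurable (fun ρ : ℝ => ρ ^ (1 - 2 * γ) * (Real.sinh ρ / ρ * auxJ (3 / 2 + γ) ρ - G)) := by
    have := aux_J_meas (3 / 2 + γ)
    have := Real.continuous_sinh.measurable
    fun_prop
  have i3 : IntervalIntegrable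
      (fun ρ : ℝ => ρ ^ (1 - 2 * γ) * (Real.sinh ρ / ρ * auxJ (3 / 2 + γ) ρ - G)) volume 0 R := by
    rw [intervalIntegrable_iff_integrableOn_Ioc_of_le hR.le] at i2 ⊢
    refine Integrable.mono' (i2.const_mul B) hm.aestronglyMeasurable ?_
    filter_upwards [ae_restrict_mem measurableSet_Ioc] with ρ hρ using hpt ρ hρ
  have e : (fun ρ : ℝ => ρ ^ (1 - 2 * γ) * (Real.sinh ρ / ρ * auxJ (3 / 2 + γ) ρ)) =
      fun ρ => ρ ^ (1 - 2 * γ) * (Real.sinh ρ / ρ * auxJ (3 / 2 + γ) ρ - G) +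
        G * ρ ^ (1 - 2 * γ) := by
    funext ρ; ring
  rw [e, intervalIntegral.integral_add i3 (i1.const_mul G), intervalIntegral.integral_const_mul,
    v1, add_sub_cancel_right, ← v2, ← intervalIntegral.integral_const_mul, ← Real.norm_eq_abs]
  refine intervalIntegral.norm_integral_le_of_norm_le hR.le ?_ (i2.const_mul B)
  exact Eventually.of_forall hpt

lemma aux_rpow_cont {R : ℝ} (hR : 0 < R) (c : ℝ) :
    ContinuousAt (fun γ : ℝ => R ^ (c - 2 * γ)) 1 := by
  apply Continuous.continuousAt
  exact Continuous.rpow continuous_const (by fun_prop) (fun x => Or.inl hR.ne')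

/-- Lemma 5.5: for fixed `R > 0`,
`I_{0,γ}(R) → 6` and `I_{∞,γ}(R) → 0` as `γ → 1⁻` (within `(0,1)`). -/
theorem scaleI_limits (R : ℝ) (hR : 0 < R) :
    Filter.Tendsto (fun γ : ℝ => scaleI0 γ R) (nhdsWithin 1 (Set.Ioo (0 : ℝ) 1)) (nhds 6) ∧
      Filter.Tendsto (fun γ : ℝ => scaleIinf γ R) (nhdsWithin 1 (Set.Ioo (0 : ℝ) 1))
        (nhds 0) := by
  have hG := aux_Gamma_cont (c := 3 / 2) (by norm_num)
  have hG' := aux_Gamma_cont (c := 1 / 2) (by norm_num)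
  have hmem : ∀ᶠ γ : ℝ in nhdsWithin 1 (Set.Ioo (0 : ℝ) 1), γ ∈ Set.Ioo (0 : ℝ) 1 :=
    self_mem_nhdsWithin
  have hmem2 : ∀ᶠ γ : ℝ in nhdsWithin 1 (Set.Ioo (0 : ℝ) 1), 3 / 4 < γ :=
    nhdsWithin_le_nhds (lt_mem_nhds (by norm_num))
  constructor
  · set M : ℝ → ℝ := fun γ => 4 * Real.pi * auxD γ * (Real.Gamma (3 / 2 + γ) * R ^ (2 - 2 * γ) / 2)
      with hM
    set E : ℝ → ℝ := fun γ => 4 * Real.pi * ((1 - γ) * auxD γ) *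
      ((Real.cosh R * Real.Gamma (3 / 2 + γ) + R / 4 * Real.Gamma (1 / 2 + γ)) *
      (R ^ (3 - 2 * γ) / (3 - 2 * γ))) with hE
    have tM : Tendsto M (nhdsWithin 1 (Set.Ioo (0 : ℝ) 1)) (nhds 6) := by
      have c : ContinuousAt M 1 := ((continuousAt_const.mul aux_D_cont).mul
        ((hG.mul (aux_rpow_cont hR 2)).div_const 2))
      have v : M 1 = 6 := by
        simp only [hM, aux_D_one]
        rw [show (3 / 2 + 1 : ℝ) = 5 / 2 by norm_num, aux_Gamma_five,
          show (2 - 2 * 1 : ℝ) = 0 by norm_num, Real.rpow_zero,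
          show (3 / 2 : ℝ) = 1 / 2 + 1 by norm_num, Real.rpow_add_one Real.pi_ne_zero]
        have := Real.pi_pos
        have : 0 < Real.pi ^ (1 / 2 : ℝ) := by positivity
        field_simp
        norm_num
      rw [← v]
      exact c.tendsto.mono_left nhdsWithin_le_nhds
    have tE : Tendsto E (nhdsWithin 1 (Set.Ioo (0 : ℝ) 1)) (nhds 0) := by
      have c : ContinuousAt E 1 := by
        refine (continuousAt_const.mul ((continuousAt_const.sub continuousAt_id).mul
          aux_D_cont)).mul (((continuousAt_const.mul hG).add (continuousAt_const.mul hG')).mul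
          ((aux_rpow_cont hR 3).div (by fun_prop) (by norm_num)))
      have v : E 1 = 0 := by simp [hE]
      rw [← v]
      exact c.tendsto.mono_left nhdsWithin_le_nhds
    have key : ∀ᶠ γ : ℝ in nhdsWithin 1 (Set.Ioo (0 : ℝ) 1), |scaleI0 γ R - M γ| ≤ |E γ| := by
      filter_upwards [hmem] with γ hγ
      have hm := aux_main hR hγ.1 hγ.2
      have e : scaleI0 γ R = 4 * Real.pi * ((1 - γ) * auxD γ) *
          (∫ ρ in (0 : ℝ)..R, ρ ^ (1 - 2 * γ) * (Real.sinh ρ / ρ * auxJ (3 / 2 + γ) ρ)) := by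
        rw [scaleI0, mul_assoc (4 * Real.pi),
          ← intervalIntegral.integral_const_mul ((1 - γ) * auxD γ)]
        congr 1
        apply intervalIntegral.integral_congr_ae
        refine (Eventually.of_forall fun ρ hρ => ?_)
        rw [Set.uIoc_of_le hR.le] at hρ
        exact aux_kernel hγ.1 hγ.2 hρ.1
      have e2 : M γ = 4 * Real.pi * ((1 - γ) * auxD γ) *
          (Real.Gamma (3 / 2 + γ) * (R ^ (2 - 2 * γ) / (2 - 2 * γ))) := by
        have : 1 - γ ≠ 0 := by linarith [hγ.2]
        rw [hM, show 2 - 2 * γ = 2 * (1 - γ) by ring]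
        field_simp
      rw [e, e2, ← mul_sub, abs_mul, hE]
      simp only
      rw [abs_mul (4 * Real.pi * ((1 - γ) * auxD γ))]
      exact mul_le_mul_of_nonneg_left (hm.trans (le_abs_self _)) (abs_nonneg _)
    have t0 : Tendsto (fun γ => scaleI0 γ R - M γ) (nhdsWithin 1 (Set.Ioo (0 : ℝ) 1)) (nhds 0) :=
      squeeze_zero_norm' key (by simpa using tE.abs)
    simpa using t0.add tM
  · set I := ∫ ρ in Set.Ioi R, (Real.exp R * besselK (5 / 2) R) *
      (ρ ^ (-(5/4) : ℝ) + ρ ^ (-(3/2) : ℝ)) with hI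
    set A : ℝ → ℝ := fun γ => 4 * Real.pi * R ^ 2 *
      ((1 - γ) * auxD γ * 2 / 2 ^ ((3 : ℝ) / 2 + γ)) with hA
    have tA : Tendsto (fun γ => |A γ| * I) (nhdsWithin 1 (Set.Ioo (0 : ℝ) 1)) (nhds 0) := by
      have c2 : ContinuousAt (fun γ : ℝ => (2:ℝ) ^ ((3 : ℝ) / 2 + γ)) 1 := by
        apply Continuous.continuousAt
        exact Continuous.rpow continuous_const (by fun_prop) (fun x => Or.inl (by norm_num))
      have c : ContinuousAt A 1 :=
        continuousAt_const.mul ((((continuousAt_const.sub continuousAt_id).mul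
          aux_D_cont).mul_const 2).div c2 (by positivity))
      have v : |A 1| * I = 0 := by simp [hA]
      rw [← v]
      exact ((c.tendsto.abs).mul_const I).mono_left nhdsWithin_le_nhds
    refine squeeze_zero_norm' ?_ tA
    filter_upwards [hmem, hmem2] with γ hγ h34
    have e : scaleIinf γ R = A γ * ∫ ρ in Set.Ioi R, Real.sinh ρ * ρ ^ (-(1 / 2 : ℝ) - γ) *
        besselK (3 / 2 + γ) ρ := by
      rw [scaleIinf, hA]
      simp only
      rw [mul_assoc (4 * Real.pi * R ^ 2), 
        ← integral_const_mul ((1 - γ) * auxD γ * 2 / 2 ^ ((3 : ℝ) / 2 + γ))]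
      congr 1
      refine setIntegral_congr_fun measurableSet_Ioi (fun ρ hρ => ?_)
      exact aux_kernel2 hγ.1 hγ.2 (hR.trans hρ)
    rw [e, norm_mul, Real.norm_eq_abs, Real.norm_eq_abs]
    gcongr
    exact aux_tail hR h34 hγ.2
end

section
/- Let α > 0 and R₀ > 0. Then for all t > 1/cosh R₀, ( arcosh(t · cosh R₀) )^{−2α} − R₀^{−2α} ≥ −2α · R₀^{−2α−2} · 𝓗(R₀) · (t − 1). -/
/-- Inverse hyperbolic cosine: `arcosh x = log(x + √(x² − 1))` for `x ≥ 1`. -/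
noncomputable def arcosh (x : ℝ) : ℝ := Real.log (x + Real.sqrt (x ^ 2 - 1))

/-- `𝓗(s) = s coth s`. -/
noncomputable def Hfun (s : ℝ) : ℝ := s * Real.cosh s / Real.sinh s

/-- Lemma 6.1, inequality (6.1): for `α, R₀ > 0` and `t > 1/cosh R₀`,
`(arcosh(t cosh R₀))^{−2α} − R₀^{−2α} ≥ −2α R₀^{−2α−2} 𝓗(R₀)(t − 1)`. -/
theorem arcosh_ineq_one (α R₀ : ℝ) (hα : 0 < α) (hR₀ : 0 < R₀) :
    ∀ t : ℝ, 1 / Real.cosh R₀ < t →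
      arcosh (t * Real.cosh R₀) ^ (-(2 * α)) - R₀ ^ (-(2 * α)) ≥
        -(2 * α) * R₀ ^ (-(2 * α) - 2) * Hfun R₀ * (t - 1) := by

  intro t ht
  have hc : 0 < Real.cosh R₀ := Real.cosh_pos R₀
  have hs : 0 < Real.sinh R₀ := Real.sinh_pos_iff.2 hR₀
  have h1 : 1 < t * Real.cosh R₀ := by rwa [div_lt_iff₀ hc] at ht
  have hdef : arcosh (t * Real.cosh R₀) = Real.arcosh (t * Real.cosh R₀) := rfl
  rw [hdef]
  have hpos := Real.arcosh_pos h1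
  have hcosh := Real.cosh_arcosh h1.le
  generalize Real.arcosh (t * Real.cosh R₀) = s at hpos hcosh
  -- convexity of cosh
  have hconv : Real.sinh R₀ * (s - R₀) ≤ Real.cosh s - Real.cosh R₀ := by
    have e1 : Real.exp R₀ * (s - R₀ + 1) ≤ Real.exp s := by
      have := mul_le_mul_of_nonneg_left (Real.add_one_le_exp (s - R₀)) (Real.exp_pos R₀).le
      rwa [← Real.exp_add, add_sub_cancel] at this
    have e2 : Real.exp (-R₀) * (R₀ - s + 1) ≤ Real.exp (-s) := by
      have := mul_le_mul_of_nonneg_left (Real.add_one_le_exp (R₀ - s)) (Real.exp_pos (-R₀)).le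
      rw [← Real.exp_add] at this
      rwa [show -R₀ + (R₀ - s) = -s by ring] at this
    rw [Real.cosh_eq, Real.cosh_eq, Real.sinh_eq]
    linarith
  -- convexity of the power
  have hpow : R₀ ^ (-(2 * α)) * (1 - 2 * α * (s / R₀ - 1)) ≤ s ^ (-(2 * α)) := by
    have hq : 0 < s / R₀ := div_pos hpos hR₀
    have h2 : s ^ (-(2 * α)) = R₀ ^ (-(2 * α)) * (s / R₀) ^ (-(2 * α)) := by
      rw [← Real.mul_rpow hR₀.le hq.le, mul_div_cancel₀ _ hR₀.ne']
    rw [h2]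
    refine mul_le_mul_of_nonneg_left ?_ (Real.rpow_nonneg hR₀.le _)
    rw [Real.rpow_def_of_pos hq]
    have h3 := Real.add_one_le_exp (Real.log (s / R₀) * -(2 * α))
    have h4 := Real.log_le_sub_one_of_pos hq
    nlinarith
  have hk : s / R₀ - 1 ≤ R₀ ^ (-2 : ℝ) * Hfun R₀ * (t - 1) := by
    have : R₀ ^ (-2 : ℝ) * Hfun R₀ * (t - 1)
        = (Real.cosh s - Real.cosh R₀) / (R₀ * Real.sinh R₀) := by
      rw [hcosh, Hfun, Real.rpow_neg hR₀.le, Real.rpow_two]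
      field_simp
    rw [this, le_div_iff₀ (by positivity)]
    have : (s / R₀ - 1) * (R₀ * Real.sinh R₀) = Real.sinh R₀ * (s - R₀) := by
      field_simp
    rw [this]; exact hconv
  have hsplit : R₀ ^ (-(2 * α) - 2) = R₀ ^ (-(2 * α)) * R₀ ^ (-2 : ℝ) := by
    rw [← Real.rpow_add hR₀]; ring_nf
  rw [hsplit]
  have hP : 0 ≤ 2 * α * R₀ ^ (-(2 * α)) := by positivity
  have := mul_le_mul_of_nonneg_left hk hP
  linarith
end

section
/- Let α > 0 and R₀ > 0. Then for all t > 1/cosh R₀, ( arcosh(t · cosh R₀) )^{−2α−2} / (t² cosh² R₀ − 1) − R₀^{−2α−2} / sinh² R₀ ≥ − R₀^{−2α} · ( (2α + 2) + 2𝓗(R₀) ) · 𝓗(R₀) · (t − 1) / ( R₀⁴ · sinh² R₀ ). -/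
lemma cosh_tangent (s R : ℝ) : Real.cosh R + (s - R) * Real.sinh R ≤ Real.cosh s := by
  have h1 : Real.exp R * (s - R + 1) ≤ Real.exp s := by
    calc Real.exp R * (s - R + 1) ≤ Real.exp R * Real.exp (s - R) :=
          mul_le_mul_of_nonneg_left (Real.add_one_le_exp _) (Real.exp_pos _).le
      _ = Real.exp s := by rw [← Real.exp_add]; congr 1; ring
  have h2 : Real.exp (-R) * (R - s + 1) ≤ Real.exp (-s) := by
    calc Real.exp (-R) * (R - s + 1) ≤ Real.exp (-R) * Real.exp (R - s) :=
          mul_le_mul_of_nonneg_left (Real.add_one_le_exp _) (Real.exp_pos _).le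
      _ = Real.exp (-s) := by rw [← Real.exp_add]; congr 1; ring
  rw [Real.cosh_eq, Real.cosh_eq, Real.sinh_eq]
  linarith

/-- Lemma 6.1, inequality (6.2): for `α, R₀ > 0` and `t > 1/cosh R₀`,
`(arcosh(t cosh R₀))^{−2α−2}/(t² cosh² R₀ − 1) − R₀^{−2α−2}/sinh² R₀
  ≥ −R₀^{−2α} ((2α+2) + 2𝓗(R₀)) 𝓗(R₀) (t − 1)/(R₀⁴ sinh² R₀)`. -/
theorem arcosh_ineq_two (α R₀ : ℝ) (hα : 0 < α) (hR₀ : 0 < R₀) :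
    ∀ t : ℝ, 1 / Real.cosh R₀ < t →
      arcosh (t * Real.cosh R₀) ^ (-(2 * α) - 2) / (t ^ 2 * Real.cosh R₀ ^ 2 - 1) -
          R₀ ^ (-(2 * α) - 2) / Real.sinh R₀ ^ 2 ≥
        -(R₀ ^ (-(2 * α))) * ((2 * α + 2) + 2 * Hfun R₀) * Hfun R₀ * (t - 1) /
          (R₀ ^ 4 * Real.sinh R₀ ^ 2) := by
  intro t ht
  have hcpos := Real.cosh_pos R₀
  have hS : 0 < Real.sinh R₀ := Real.sinh_pos_iff.2 hR₀
  have hc1 : 1 < Real.cosh R₀ := Real.one_lt_cosh.2 hR₀.ne'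
  have hcS : Real.cosh R₀ ^ 2 = Real.sinh R₀ ^ 2 + 1 := Real.cosh_sq R₀
  have hx : 1 < t * Real.cosh R₀ := by rwa [div_lt_iff₀ hcpos] at ht
  have hs : 0 < arcosh (t * Real.cosh R₀) := Real.arcosh_pos hx
  have hcs : Real.cosh (arcosh (t * Real.cosh R₀)) = t * Real.cosh R₀ := Real.cosh_arcosh hx.le
  have htan := cosh_tangent (arcosh (t * Real.cosh R₀)) R₀
  rw [hcs] at htan
  generalize arcosh (t * Real.cosh R₀) = s at *
  unfold Hfun
  generalize Real.cosh R₀ = c at *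
  generalize Real.sinh R₀ = S at *
  have hx1 : 0 < t * c - 1 := by linarith
  have hx2 : 0 < t * c + 1 := by linarith
  have hd1 : 0 < c - 1 := by linarith
  have hd2 : 0 < c + 1 := by linarith
  have hx2e : t ^ 2 * c ^ 2 - 1 = (t * c - 1) * (t * c + 1) := by ring
  have hSe : S ^ 2 = (c - 1) * (c + 1) := by linarith
  have l1 : Real.log (s / R₀) ≤ c * (t - 1) / (R₀ * S) := by
    refine (Real.log_le_sub_one_of_pos (by positivity)).trans ?_
    rw [div_sub_one hR₀.ne', div_le_div_iff₀ hR₀ (by positivity)]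
    nlinarith
  have l2 : Real.log ((t * c - 1) / (c - 1)) ≤ c * (t - 1) / (c - 1) := by
    refine (Real.log_le_sub_one_of_pos (by positivity)).trans (le_of_eq ?_)
    field_simp; ring
  have l3 : Real.log ((t * c + 1) / (c + 1)) ≤ c * (t - 1) / (c + 1) := by
    refine (Real.log_le_sub_one_of_pos (by positivity)).trans (le_of_eq ?_)
    field_simp; ring
  have l23 : c * (t - 1) / (c - 1) + c * (t - 1) / (c + 1) = 2 * c ^ 2 * (t - 1) / S ^ 2 := by
    rw [hSe]; field_simp; ring
  have hp : (-(2 * α) - 2) * Real.log (s / R₀) ≥ (-(2 * α) - 2) * (c * (t - 1) / (R₀ * S)) := by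
    nlinarith
  have key : 1 + ((-(2 * α) - 2) * (c * (t - 1) / (R₀ * S)) - 2 * c ^ 2 * (t - 1) / S ^ 2) ≤
      (s / R₀) ^ (-(2 * α) - 2) * (S ^ 2 / (t ^ 2 * c ^ 2 - 1)) := by
    have hA : 0 < S ^ 2 / (t ^ 2 * c ^ 2 - 1) := by rw [hx2e]; positivity
    have hB : 0 < (s / R₀) ^ (-(2 * α) - 2) := by positivity
    have h0 := Real.log_le_sub_one_of_pos (mul_pos hB hA)
    rw [Real.log_mul hB.ne' hA.ne', Real.log_rpow (by positivity), hx2e, hSe,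
      Real.log_div (mul_pos hd1 hd2).ne' (mul_pos hx1 hx2).ne', Real.log_mul hx1.ne' hx2.ne',
      Real.log_mul hd1.ne' hd2.ne', ← hx2e, ← hSe] at h0
    rw [Real.log_div hx1.ne' hd1.ne'] at l2
    rw [Real.log_div hx2.ne' hd2.ne'] at l3
    linarith
  have hR2 : R₀ ^ (-(2 * α) - 2) = R₀ ^ (-(2 * α)) / R₀ ^ 2 := by
    rw [Real.rpow_sub hR₀]; norm_num
  have hP : 0 < R₀ ^ (-(2 * α)) := by positivity
  rw [Real.div_rpow hs.le hR₀.le, hR2] at key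
  rw [hR2]
  generalize R₀ ^ (-(2 * α)) = P at *
  generalize s ^ (-(2 * α) - 2) = Q at *
  have hD : 0 < t ^ 2 * c ^ 2 - 1 := by rw [hx2e]; positivity
  generalize t ^ 2 * c ^ 2 - 1 = D at *
  have hk := mul_le_mul_of_nonneg_left key (show 0 ≤ P / R₀ ^ 2 / S ^ 2 by positivity)
  have e1 : P / R₀ ^ 2 / S ^ 2 * (Q / (P / R₀ ^ 2) * (S ^ 2 / D)) = Q / D := by field_simp
  have e2 : P / R₀ ^ 2 / S ^ 2 *
      (1 + ((-(2 * α) - 2) * (c * (t - 1) / (R₀ * S)) - 2 * c ^ 2 * (t - 1) / S ^ 2)) =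
      P / R₀ ^ 2 / S ^ 2 + -P * ((2 * α + 2) + 2 * (R₀ * c / S)) * (R₀ * c / S) * (t - 1) /
          (R₀ ^ 4 * S ^ 2) := by
    field_simp; ring
  rw [e1, e2] at hk
  linarith
end
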